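/- Let 𝒜 = {L_1, …, L_n} be n ≥ 1 pairwise distinct affine lines in ℂ², let K be a field, and let C ⊆ {1, …, n} be a parallel class of 𝒜. Then the images of the elements e_i ∧ e_j, for i ∈ C and j ∉ C, in the quotient Λ(K^n)/I_K(𝒜) are K-linearly independent. -/

import Mathlib

noncomputable section
open scoped Classical

/-- `L` is an (affine) line in `ℂ²`: a nonempty affine subspace whose direction
has dimension one. -/
def IsLine (L : AffineSubspace ℂ (ℂ × ℂ)) : Prop :=
  (L : Set (ℂ × ℂ)).Nonempty ∧ Module.finrank ℂ L.direction = 1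

/-- Indices `i`, `j` are parallel: `i = j` or the lines do not meet. -/
def Par {n : ℕ} (L : Fin n → AffineSubspace ℂ (ℂ × ℂ)) (i j : Fin n) : Prop :=
  i = j ∨ (L i : Set (ℂ × ℂ)) ∩ (L j : Set (ℂ × ℂ)) = ∅

/-- The image `e_i` of the `i`-th standard basis vector of `R^n` in `Λ(R^n)`. -/
def gen (R : Type*) [CommRing R] (n : ℕ) (i : Fin n) :
    ExteriorAlgebra R (Fin n → R) :=
  ExteriorAlgebra.ι R (Pi.single i 1)

/-- Generators of the Orlik-Solomon ideal of the line arrangement `L`. -/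
def osGens (R : Type*) [CommRing R] {n : ℕ}
    (L : Fin n → AffineSubspace ℂ (ℂ × ℂ)) :
    Set (ExteriorAlgebra R (Fin n → R)) :=
  {x | ∃ i j : Fin n, i ≠ j ∧ (L i : Set (ℂ × ℂ)) ∩ (L j : Set (ℂ × ℂ)) = ∅ ∧
        x = gen R n i * gen R n j} ∪
  {x | ∃ i j k : Fin n, i ≠ j ∧ i ≠ k ∧ j ≠ k ∧
        ((L i : Set (ℂ × ℂ)) ∩ (L j : Set (ℂ × ℂ)) ∩ (L k : Set (ℂ × ℂ))).Nonempty ∧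
        x = gen R n i * gen R n j - gen R n i * gen R n k + gen R n j * gen R n k}

/-- The Orlik-Solomon ideal `I_R(𝒜)`: the two-sided ideal generated by `osGens`. -/
def osIdeal (R : Type*) [CommRing R] {n : ℕ}
    (L : Fin n → AffineSubspace ℂ (ℂ × ℂ)) :
    TwoSidedIdeal (ExteriorAlgebra R (Fin n → R)) :=
  TwoSidedIdeal.span (osGens R L)

/-- The parallel class of the index `i`, as a finset of indices. -/
def parClass {n : ℕ} (L : Fin n → AffineSubspace ℂ (ℂ × ℂ)) (i : Fin n) :
    Finset (Fin n) :=
  Finset.univ.filter (fun j => Par L i j)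

/-- The Orlik-Solomon ideal, viewed as an `R`-submodule of `Λ(R^n)` (it is closed
under scalar multiplication since scalars are central). -/
def osIdealSubmodule (R : Type*) [CommRing R] {n : ℕ}
    (L : Fin n → AffineSubspace ℂ (ℂ × ℂ)) :
    Submodule R (ExteriorAlgebra R (Fin n → R)) where
  carrier := osIdeal R L
  add_mem' hx hy := (osIdeal R L).add_mem hx hy
  zero_mem' := (osIdeal R L).zero_mem
  smul_mem' r x hx := by
    rw [Algebra.smul_def]
    exact (osIdeal R L).mul_mem_left _ _ hx

open ExteriorAlgebra in
theorem ι_cons_mul_ι_cons {R : Type*} [CommRing R] (a b c d : R) :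
    ι R ![a, b] * ι R ![c, d] = (a * d - c * b) • (ι R ![(1 : R), 0] * ι R ![(0 : R), 1]) := by
  have key (x y : R) : ι R ![x, y] = x • ι R ![(1 : R), 0] + y • ι R ![(0 : R), 1] := by
    rw [← map_smul, ← map_smul, ← map_add]
    simp
  have hswap : ι R ![(0 : R), 1] * ι R ![(1 : R), 0] =
      -(ι R ![(1 : R), 0] * ι R ![(0 : R), 1]) :=
    eq_neg_of_add_eq_zero_left (ι_add_mul_swap _ _)
  rw [key a b, key c d]
  simp only [add_mul, mul_add, smul_mul_smul_comm, ι_sq_zero, hswap]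
  module

open ExteriorAlgebra in
theorem ι_mul_ι_ne_zero {R : Type*} [CommRing R] [Nontrivial R] :
    ι R ![(1 : R), 0] * ι R ![(0 : R), 1] ≠ 0 := by
  intro h
  have h2 : ιMulti R 2 ![![(1 : R), 0], ![(0 : R), 1]] = 0 := by
    simpa [ιMulti_apply] using h
  have h3 := congrArg
    (liftAlternating (R := R) (M := Fin 2 → R) (N := R) (Pi.single 2 Matrix.detRowAlternating)) h2
  rw [liftAlternating_apply_ιMulti, Pi.single_eq_same, map_zero] at h3
  have hdet : Matrix.det !![(1 : R), 0; 0, 1] = 0 := h3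
  simp [Matrix.det_fin_two] at hdet

theorem IsLine.direction_eq_of_inter_eq_empty {L M : AffineSubspace ℂ (ℂ × ℂ)} (hL : IsLine L)
    (hM : IsLine M) (h : (L : Set (ℂ × ℂ)) ∩ M = ∅) : L.direction = M.direction := by
  by_contra hne
  have hinf : L.direction ⊓ M.direction = ⊥ := by
    by_contra hbot
    have hpos := Submodule.one_le_finrank_iff.2 hbot
    refine hne ?_
    rw [← Submodule.eq_of_le_of_finrank_le (inf_le_left : L.direction ⊓ M.direction ≤ _)
      (hL.2.trans_le hpos)]
    exact Submodule.eq_of_le_of_finrank_le inf_le_right (hM.2.trans_le hpos)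
  have htop : L.direction ⊔ M.direction = ⊤ := by
    apply Submodule.eq_top_of_finrank_eq
    have := Submodule.finrank_sup_add_finrank_inf_eq L.direction M.direction
    rw [hinf, finrank_bot, hL.2, hM.2] at this
    rw [Module.finrank_prod, Module.finrank_self]
    omega
  exact (AffineSubspace.inter_nonempty_of_nonempty_of_sup_direction_eq_top hL.1 hM.1 htop).ne_empty h

theorem IsLine.eq_of_mem {L M : AffineSubspace ℂ (ℂ × ℂ)} (hL : IsLine L) (hM : IsLine M)
    {p q : ℂ × ℂ} (hpq : p ≠ q) (hpL : p ∈ L) (hqL : q ∈ L) (hpM : p ∈ M) (hqM : q ∈ M) :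
    L = M := by
  have key {N : AffineSubspace ℂ (ℂ × ℂ)} (hN : IsLine N) (hp : p ∈ N) (hq : q ∈ N) :
      Submodule.span ℂ {p -ᵥ q} = N.direction := by
    apply Submodule.eq_of_le_of_finrank_le
    · rw [Submodule.span_singleton_le_iff_mem]
      exact AffineSubspace.vsub_mem_direction hp hq
    · rw [hN.2, finrank_span_singleton (vsub_ne_zero.2 hpq)]
  exact AffineSubspace.ext_of_direction_eq ((key hL hpL hqL).symm.trans (key hM hpM hqM))
    ⟨p, hpL, hpM⟩

theorem par_iff_direction_eq {n : ℕ} {L : Fin n → AffineSubspace ℂ (ℂ × ℂ)}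
    (hline : ∀ i, IsLine (L i)) (hdist : Function.Injective L) {i j : Fin n} :
    Par L i j ↔ (L i).direction = (L j).direction := by
  refine ⟨?_, fun h => ?_⟩
  · rintro (rfl | h)
    · rfl
    · exact (hline i).direction_eq_of_inter_eq_empty (hline j) h
  · rcases Set.eq_empty_or_nonempty ((L i : Set (ℂ × ℂ)) ∩ L j) with he | hne
    · exact Or.inr he
    · exact Or.inl (hdist (AffineSubspace.ext_of_direction_eq h hne))

/-- The algebra map `Λ(K^n) → Λ(K^2)` sending `e_i` to `(s_i, t_i)`, where `s_i` indicates
that `L i` passes through `p`, and `t_i` that `i = b`. -/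
def pencilMap (K : Type*) [Field K] {n : ℕ} (L : Fin n → AffineSubspace ℂ (ℂ × ℂ))
    (p : ℂ × ℂ) (b : Fin n) :
    ExteriorAlgebra K (Fin n → K) →ₐ[K] ExteriorAlgebra K (Fin 2 → K) :=
  ExteriorAlgebra.map (Fintype.linearCombination K
    fun i => ![if p ∈ L i then (1 : K) else 0, if i = b then (1 : K) else 0])

section pencilMap

variable {K : Type*} [Field K] {n : ℕ} {L : Fin n → AffineSubspace ℂ (ℂ × ℂ)}
  {p : ℂ × ℂ} {b : Fin n}

theorem pencilMap_gen_mul_gen (i j : Fin n) :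
    pencilMap K L p b (gen K n i * gen K n j) =
      ((if p ∈ L i then (1 : K) else 0) * (if j = b then 1 else 0) -
        (if p ∈ L j then 1 else 0) * (if i = b then 1 else 0)) •
      (ExteriorAlgebra.ι K ![(1 : K), 0] * ExteriorAlgebra.ι K ![(0 : K), 1]) := by
  simp only [pencilMap, gen, map_mul, ExteriorAlgebra.map_apply_ι,
    Fintype.linearCombination_apply_single, one_smul]
  exact ι_cons_mul_ι_cons _ _ _ _

theorem pencilMap_eq_zero_of_mem_osGens (hline : ∀ i, IsLine (L i))
    (hdist : Function.Injective L) (hb : p ∈ L b) {x : ExteriorAlgebra K (Fin n → K)}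
    (hx : x ∈ osGens K L) : pencilMap K L p b x = 0 := by
  rcases hx with ⟨i, j, -, hij, rfl⟩ | ⟨i, j, k, hij, hik, hjk, ⟨q, ⟨hqi, hqj⟩, hqk⟩, rfl⟩
  · have hnot : ¬ (p ∈ L i ∧ p ∈ L j) := fun h =>
      Set.eq_empty_iff_forall_notMem.1 hij p h
    rw [pencilMap_gen_mul_gen]
    refine smul_eq_zero_of_left ?_ _
    grind
  · rw [map_add, map_sub, pencilMap_gen_mul_gen, pencilMap_gen_mul_gen, pencilMap_gen_mul_gen,
      ← sub_smul, ← add_smul]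
    refine smul_eq_zero_of_left ?_ _
    have hqi : q ∈ L i := hqi
    have hqj : q ∈ L j := hqj
    have hqk : q ∈ L k := hqk
    by_cases hpq : p = q
    · subst hpq
      simp only [hqi, hqj, hqk, if_true]
      ring
    · have huniq (m : Fin n) (hq : q ∈ L m) (hqb : q ∈ L b) (hm : p ∈ L m) : m = b :=
        hdist ((hline m).eq_of_mem (hline b) hpq hm hq hb hqb)
      grind

theorem pencilMap_eq_zero_of_mem_osIdeal (hline : ∀ i, IsLine (L i))
    (hdist : Function.Injective L) (hb : p ∈ L b) {x : ExteriorAlgebra K (Fin n → K)}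
    (hx : x ∈ osIdeal K L) : pencilMap K L p b x = 0 := by
  have hle : osIdeal K L ≤ TwoSidedIdeal.ker (pencilMap K L p b) :=
    TwoSidedIdeal.span_le.2 fun y hy => (TwoSidedIdeal.mem_ker _).2
      (pencilMap_eq_zero_of_mem_osGens hline hdist hb hy)
  exact (TwoSidedIdeal.mem_ker _).1 (hle hx)

end pencilMap

/-- Let `C` be the parallel class of the index `i₀`. The images of
the products `eᵢ ∧ eⱼ`, for `i ∈ C` and `j ∉ C`, in the quotient `Λ(K^n)/I_K(𝒜)` are
linearly independent over the field `K`. -/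
theorem linearIndependent_mixed_products
    {n : ℕ} (hn : 1 ≤ n) (L : Fin n → AffineSubspace ℂ (ℂ × ℂ))
    (hline : ∀ i, IsLine (L i)) (hdist : Function.Injective L)
    (K : Type*) [Field K] (i₀ : Fin n) :
    LinearIndependent K
      (fun q : {q : Fin n × Fin n // Par L i₀ q.1 ∧ ¬ Par L i₀ q.2} =>
        Submodule.Quotient.mk (p := osIdealSubmodule K L)
          (gen K n q.1.1 * gen K n q.1.2)) := by
  rw [linearIndependent_iff']
  rintro s c hsum ⟨⟨a, b⟩, ha, hb⟩ hq
  have hpar {i j : Fin n} := par_iff_direction_eq hline hdist (i := i) (j := j)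
  have hab : ¬ Par L a b := fun h => hb (hpar.2 ((hpar.1 ha).trans (hpar.1 h)))
  obtain ⟨p, hpa, hpb⟩ := Set.nonempty_iff_ne_empty.2 fun h => hab (Or.inr h)
  have hker : osIdealSubmodule K L ≤ LinearMap.ker (pencilMap K L p b).toLinearMap :=
    fun x hx => pencilMap_eq_zero_of_mem_osIdeal hline hdist hpb hx
  have happ := congrArg ((osIdealSubmodule K L).liftQ _ hker) hsum
  simp only [map_sum, map_smul, map_zero, Submodule.liftQ_apply, AlgHom.toLinearMap_apply,
    pencilMap_gen_mul_gen] at happ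
  rw [Finset.sum_eq_single_of_mem _ hq] at happ
  · have hne : a ≠ b := fun h => hab (Or.inl h)
    have hpa : p ∈ L a := hpa
    simpa [hpa, hne, ι_mul_ι_ne_zero] using happ
  · rintro ⟨⟨i, j⟩, hi, hj⟩ - hne
    have hib : i ≠ b := fun h => hb (h ▸ hi)
    have hzero : ¬ (p ∈ L i ∧ j = b) := by
      rintro ⟨hpi, rfl⟩
      have : i = a := hdist (AffineSubspace.ext_of_direction_eq
        ((hpar.1 hi).symm.trans (hpar.1 ha)) ⟨p, hpi, hpa⟩)
      exact hne (by subst this; rfl)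
    have hz : (if p ∈ L i then (1 : K) else 0) * (if j = b then 1 else 0) = 0 := by grind
    simp [hz, hib]
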